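/- For an integer m ≥ 1 and t > 0, let g(w_1, ..., w_m) = exp(-w_m^{-1}) · Π_{i=1}^{m} w_i^{-2}, defined for w_1 > w_2 > ... > w_m > 0, and let D(t) = {(w, z) ∈ ℝ^m × ℝ^m : z_1 > z_2 > ... > z_m > 0, w_2 < w_1 < t·z_1, w_3 < w_2 < t·z_2, ..., w_m < w_{m-1} < t·z_{m-1}, 0 < w_m < t·z_m}. Then, with k = 1 + 1/t, ∫_{D(t)} g(w_1, ..., w_m)·g(z_1, ..., z_m) dw dz = [Σ_{j=0}^{m-1} (-1)^j · B_{m-1,j} · k^{m-j-1}] / k^{2m-1}, where B_{m,j} = binom(2m+2, m-j)·binom(m+j, m)/(m+1). -/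

import Mathlib

open MeasureTheory Finset

/-- Borel's triangle: `B_{m,j} = C(2m+2, m-j) * C(m+j, m) / (m+1)`. -/
noncomputable def borelTri (m j : ℕ) : ℝ :=
  (Nat.choose (2 * m + 2) (m - j) * Nat.choose (m + j) m : ℝ) / (m + 1)


/-- ballot numbers -/
noncomputable def bal (i h : ℕ) : ℝ :=
  ((h : ℝ) + 1) * (2 * i + h).factorial / (i.factorial * (i + h + 1).factorial)

lemma bal_zero (h : ℕ) : bal 0 h = 1 := by
  unfold bal
  have : ((h.factorial : ℕ) : ℝ) ≠ 0 := by positivity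
  have h2 : (h : ℝ) + 1 ≠ 0 := by positivity
  simp only [Nat.factorial_succ, Nat.mul_zero, Nat.zero_add, Nat.factorial_zero, Nat.cast_one,
    one_mul, Nat.cast_mul, Nat.cast_add]
  exact div_self (mul_ne_zero h2 this)

lemma bal_succ_zero (i : ℕ) : bal (i + 1) 0 = bal i 1 := by
  unfold bal
  have e1 : 2 * (i + 1) + 0 = (2 * i + 1) + 1 := by ring
  have e2 : i + 1 + 0 + 1 = i + 1 + 1 := by ring
  rw [e1, e2, Nat.factorial_succ (2 * i + 1), Nat.factorial_succ i]
  have h1 : ((i.factorial : ℕ) : ℝ) ≠ 0 := by positivity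
  have h2 : (((i+1+1).factorial : ℕ) : ℝ) ≠ 0 := by positivity
  push_cast
  field_simp
  ring

lemma bal_succ_succ (i h : ℕ) : bal (i + 1) (h + 1) = bal i (h + 2) + bal (i + 1) h := by
  unfold bal
  have e1 : 2 * (i + 1) + (h + 1) = (2 * i + h + 2) + 1 := by ring
  have e2 : i + 1 + (h + 1) + 1 = (i + h + 2) + 1 := by ring
  have e3 : 2 * i + (h + 2) = 2 * i + h + 2 := by ring
  have e4 : i + (h + 2) + 1 = (i + h + 2) + 1 := by ring
  have e5 : 2 * (i + 1) + h = 2 * i + h + 2 := by ring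
  have e6 : i + 1 + h + 1 = i + h + 2 := by ring
  rw [e1, e2, e3, e4, e5, e6, Nat.factorial_succ (2 * i + h + 2), Nat.factorial_succ i,
    Nat.factorial_succ (i + h + 2)]
  have h1 : ((i.factorial : ℕ) : ℝ) ≠ 0 := by positivity
  have h2 : (((i+h+2).factorial : ℕ) : ℝ) ≠ 0 := by positivity
  have h3 : ((i:ℝ) + h + 2 + 1) ≠ 0 := by positivity
  push_cast
  field_simp
  ring

noncomputable def QQ (p q : ℝ) (n h : ℕ) : ℝ :=
  ∑ i ∈ range (n - h), bal i h * p ^ i * q ^ (i + h + 1)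

lemma QQ_self (p q : ℝ) (n h : ℕ) (hh : n ≤ h) : QQ p q n h = 0 := by
  unfold QQ; rw [Nat.sub_eq_zero_of_le hh]; simp

lemma QQ_rec (p q : ℝ) (n h : ℕ) :
    QQ p q (n + 1) (h + 1) = p * QQ p q (n + 1) (h + 2) + q * QQ p q n h := by
  unfold QQ
  rcases Nat.eq_zero_or_pos (n - h) with h0 | h0
  · have e1 : n + 1 - (h + 1) = 0 := by omega
    have e2 : n + 1 - (h + 2) = 0 := by omega
    simp [h0, e1, e2]
  · obtain ⟨M, hM⟩ : ∃ M, n - h = M + 1 := ⟨n - h - 1, by omega⟩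
    have e1 : n + 1 - (h + 1) = M + 1 := by omega
    have e2 : n + 1 - (h + 2) = M := by omega
    have key : ∑ i ∈ range M, bal (i + 1) (h + 1) * p ^ (i + 1) * q ^ (i + 1 + (h + 1) + 1) =
        p * ∑ i ∈ range M, bal i (h + 2) * p ^ i * q ^ (i + (h + 2) + 1) +
        q * ∑ i ∈ range M, bal (i + 1) h * p ^ (i + 1) * q ^ (i + 1 + h + 1) := by
      rw [mul_sum, mul_sum, ← sum_add_distrib]
      apply sum_congr rfl
      intro i _
      rw [bal_succ_succ]; ring
    rw [e1, e2, hM, sum_range_succ' _ M, sum_range_succ' _ M, bal_zero, bal_zero, key]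
    ring

lemma QQ_rec_zero (p q : ℝ) (n : ℕ) :
    QQ p q (n + 1) 0 = p * QQ p q (n + 1) 1 + q := by
  unfold QQ
  have e1 : n + 1 - 0 = n + 1 := by omega
  have e2 : n + 1 - 1 = n := by omega
  rw [e1, e2, sum_range_succ', mul_sum, bal_zero]
  congr 1
  · apply sum_congr rfl
    intro i _
    rw [bal_succ_zero]; ring
  · ring

lemma bor_mid (m j : ℕ) (hj : j + 1 ≤ m) :
    borelTri m (j + 1) + borelTri (m + 1) j = bal (m + 1) 0 * (m + 2).choose (j + 1) := by
  obtain ⟨d, rfl⟩ := Nat.exists_eq_add_of_le hj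
  unfold borelTri bal
  have e1 : j + 1 + d - (j + 1) = d := by omega
  have e2 : j + 1 + d + 1 - j = d + 2 := by omega
  rw [e1, e2, Nat.cast_choose ℝ (show d ≤ 2 * (j + 1 + d) + 2 by omega),
    Nat.cast_choose ℝ (show j + 1 + d ≤ j + 1 + d + (j + 1) by omega),
    Nat.cast_choose ℝ (show d + 2 ≤ 2 * (j + 1 + d + 1) + 2 by omega),
    Nat.cast_choose ℝ (show j + 1 + d + 1 ≤ j + 1 + d + 1 + j by omega),
    Nat.cast_choose ℝ (show j + 1 ≤ j + 1 + d + 2 by omega)]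
  have a1 : 2 * (j + 1 + d) + 2 - d = (2 * j + d + 3) + 1 := by omega
  have a2 : j + 1 + d + (j + 1) - (j + 1 + d) = j + 1 := by omega
  have a3 : 2 * (j + 1 + d + 1) + 2 - (d + 2) = (2 * j + d + 3) + 1 := by omega
  have a4 : j + 1 + d + 1 + j - (j + 1 + d + 1) = j := by omega
  have a5 : j + 1 + d + 2 - (j + 1) = d + 2 := by omega
  have a6 : 2 * (j + 1 + d) + 2 = 2 * j + 2 * d + 4 := by omega
  have a7 : 2 * (j + 1 + d + 1) + 2 = (2 * j + 2 * d + 4) + 1 + 1 := by omega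
  have a8 : j + 1 + d + (j + 1) = 2 * j + d + 2 := by omega
  have a9 : j + 1 + d + 1 + j = 2 * j + d + 2 := by omega
  have a10 : 2 * (j + 1 + d + 1) + 0 = 2 * j + 2 * d + 4 := by omega
  have a11 : j + 1 + d + 1 + 0 + 1 = (j + d + 1) + 1 + 1 := by omega
  have a12 : j + 1 + d + 1 = (j + d + 1) + 1 := by omega
  have a13 : j + 1 + d = (j + d + 1) := by omega
  have a14 : j + 1 + d + 2 = (j + d + 1) + 1 + 1 := by omega
  rw [a1, a2, a3, a4, a5, a6, a7, a8, a9, a10, a11, a12, a13]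
  rw [show j + d + 1 + 2 = (j + d + 1) + 1 + 1 by omega]
  rw [show (2 * j + d + 3) + 1 = (2 * j + d + 2) + 1 + 1 by omega]
  simp only [Nat.factorial_succ]
  generalize hA : ((2 * j + d).factorial) = A
  have h1 : ((d.factorial : ℕ) : ℝ) ≠ 0 := by positivity
  have h2 : ((j.factorial : ℕ) : ℝ) ≠ 0 := by positivity
  have h3 : (((j+d).factorial : ℕ) : ℝ) ≠ 0 := by positivity
  have h4 : (A : ℝ) ≠ 0 := by rw [← hA]; positivity
  push_cast
  field_simp
  ring

lemma bor_zero (m : ℕ) : borelTri m 0 = bal (m + 1) 0 := by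
  unfold borelTri bal
  rw [Nat.cast_choose ℝ (show m - 0 ≤ 2 * m + 2 by omega)]
  have a1 : 2 * m + 2 - (m - 0) = m + 2 := by omega
  rw [a1, show m - 0 = m by omega, show m + 0 = m by omega, show 2 * (m+1) + 0 = 2 * m + 2 by omega,
   show m + 1 + 0 + 1 = m + 2 by omega, Nat.factorial_succ m]
  have h1 : ((m.factorial : ℕ) : ℝ) ≠ 0 := by positivity
  have h2 : (((m+2).factorial : ℕ) : ℝ) ≠ 0 := by positivity
  simp
  field_simp

lemma bor_pen (m : ℕ) : borelTri (m + 1) m = bal (m + 1) 0 * (m + 2) := by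
  unfold borelTri bal
  have a1 : m + 1 - m = 1 := by omega
  rw [a1, Nat.cast_choose ℝ (show m + 1 ≤ m + 1 + m by omega)]
  rw [show m + 1 + m - (m + 1) = m by omega, show m + 1 + m = 2 * m + 1 by omega,
    show 2 * (m+1) + 0 = 2 * m + 1 + 1 by omega, Nat.factorial_succ (2 * m + 1),
    show m + 1 + 0 + 1 = m + 1 + 1 by omega, Nat.factorial_succ (m + 1), Nat.factorial_succ m]
  have h1 : ((m.factorial : ℕ) : ℝ) ≠ 0 := by positivity
  simp
  field_simp
  ring

lemma bor_last (m : ℕ) : borelTri (m + 1) (m + 1) = bal (m + 1) 0 := by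
  unfold borelTri bal
  rw [Nat.cast_choose ℝ (show m + 1 ≤ m + 1 + (m + 1) by omega)]
  rw [show m + 1 + (m + 1) - (m + 1) = m + 1 by omega, show m + 1 + (m + 1) = 2 * m + 2 by omega,
    show 2 * (m+1) + 0 = 2 * m + 2 by omega,
    show m + 1 + 0 + 1 = m + 1 + 1 by omega, Nat.factorial_succ (m + 1)]
  have h1 : (((m+1).factorial : ℕ) : ℝ) ≠ 0 := by positivity
  simp
  field_simp

lemma bor_step (m : ℕ) (u : ℝ) :
    (∑ j ∈ range (m + 1), (-1 : ℝ) ^ j * borelTri m j * u ^ j) -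
      u * (∑ j ∈ range (m + 2), (-1 : ℝ) ^ j * borelTri (m + 1) j * u ^ j) =
    bal (m + 1) 0 * (1 - u) ^ (m + 2) := by
  have hb : (1 - u) ^ (m + 2) =
      ∑ j ∈ range (m + 3), (-1 : ℝ) ^ j * u ^ j * ((m + 2).choose j : ℝ) := by
    rw [show (1 - u) = (-u) + 1 by ring, add_pow]
    apply sum_congr rfl
    intro j _
    rw [neg_pow]; simp
  have key : ∑ j ∈ range m, ((-1 : ℝ) ^ (j+1) * borelTri m (j+1) * u ^ (j+1))
      - u * ∑ j ∈ range m, (-1 : ℝ) ^ j * borelTri (m + 1) j * u ^ j =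
      bal (m + 1) 0 * ∑ j ∈ range m, (-1 : ℝ) ^ (j+1) * u ^ (j+1) * ((m + 2).choose (j+1) : ℝ) := by
    rw [mul_sum, mul_sum, ← sum_sub_distrib]
    apply sum_congr rfl
    intro j hj
    have := bor_mid m j (by simpa using hj)
    linear_combination (-1 : ℝ) ^ (j+1) * u ^ (j+1) * this
  rw [hb, sum_range_succ' _ m, sum_range_succ' _ (m + 2), sum_range_succ _ (m + 1),
    sum_range_succ _ m, sum_range_succ _ (m + 1), sum_range_succ _ m, bor_zero, bor_pen, bor_last]
  have c1 : ((m + 2).choose (m + 1) : ℝ) = m + 2 := by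
    rw [Nat.choose_succ_self_right]; push_cast; ring
  have c2 : ((m + 2).choose (m + 1 + 1) : ℝ) = 1 := by
    rw [Nat.choose_self]; simp
  rw [c1, c2]
  simp only [Nat.choose_zero_right, Nat.cast_one, pow_zero]
  linear_combination key

lemma bor_main (m : ℕ) (u : ℝ) :
    1 - QQ u (1 - u) (m + 1) 0 =
      u ^ (m + 1) * ∑ j ∈ range (m + 1), (-1 : ℝ) ^ j * borelTri m j * u ^ j := by
  induction m with
  | zero => simp [QQ, bal_zero, borelTri]
  | succ m ih =>
    have hq : QQ u (1 - u) (m + 1 + 1) 0 = QQ u (1 - u) (m + 1) 0 +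
        bal (m + 1) 0 * u ^ (m + 1) * (1 - u) ^ (m + 2) := by
      unfold QQ
      simp only [Nat.sub_zero]
      rw [sum_range_succ]
    have := bor_step m u
    rw [hq]
    linear_combination ih + u ^ (m + 1) * this

lemma bor_final (m : ℕ) (hm : 1 ≤ m) (t : ℝ) (ht : 0 < t) :
    1 - QQ (t / (1 + t)) (1 / (1 + t)) m 0 =
     (∑ j ∈ Finset.range m, (-1 : ℝ) ^ j * borelTri (m - 1) j * (1 + 1 / t) ^ (m - j - 1)) /
        (1 + 1 / t) ^ (2 * m - 1) := by
  obtain ⟨n, rfl⟩ : ∃ n, m = n + 1 := ⟨m - 1, by omega⟩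
  have h1 : 1 / (1 + t) = 1 - t / (1 + t) := by field_simp; ring
  have hk : (1 + 1 / t) = (t / (1 + t))⁻¹ := by field_simp; ring
  have hu : t / (1 + t) ≠ 0 := by positivity
  rw [h1, bor_main, hk]
  generalize t / (1 + t) = u at hu
  rw [eq_div_iff (by positivity), mul_sum, sum_mul]
  apply sum_congr rfl
  intro j hj
  have hj' : j ≤ n := by simpa [Nat.lt_succ_iff] using hj
  obtain ⟨d, rfl⟩ := Nat.exists_eq_add_of_le hj'
  rw [show j + d + 1 - 1 = j + d by omega, show j + d + 1 - j - 1 = d by omega,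
    show 2 * (j + d + 1) - 1 = (j + d + 1) + j + d by omega]
  simp only [inv_pow, pow_add]
  field_simp

noncomputable def SS (c : ℕ → ℝ) (n : ℕ) (s : ℝ) : ℝ :=
  ∑ N ∈ range n, c N * (s ^ N / N.factorial)

lemma SS_deriv (c : ℕ → ℝ) (n : ℕ) (s : ℝ) :
    HasDerivAt (SS c (n + 1)) (SS (fun N => c (N + 1)) n s) s := by
  have e : SS c (n + 1) =
      fun s => (∑ N ∈ range n, c (N + 1) * (s ^ (N + 1) / (N + 1).factorial)) + c 0 := by
    funext s; unfold SS; rw [sum_range_succ']; simp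
  rw [e]
  apply HasDerivAt.add_const
  unfold SS
  apply HasDerivAt.fun_sum
  intro N _
  apply HasDerivAt.const_mul
  have h := (hasDerivAt_pow (N + 1) s).div_const ((N + 1).factorial : ℝ)
  convert h using 1
  have h1 : ((N.factorial : ℕ) : ℝ) ≠ 0 := by positivity
  rw [Nat.factorial_succ]
  push_cast
  field_simp

noncomputable def QP (p q : ℝ) (n : ℕ) : ℕ → ℝ
  | 0 => 1
  | N + 1 => QQ p q n N

noncomputable def FF (t : ℝ) (n : ℕ) (a b : ℝ) : ℝ :=
  Real.exp (-a - b) - Real.exp (-((1 + t) * a)) *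
    SS (QQ (t / (1 + t)) (1 / (1 + t)) n) n (t * a - b)

noncomputable def HH (t : ℝ) (n : ℕ) (a b : ℝ) : ℝ :=
  Real.exp (-a - b) - Real.exp (-((1 + t) * a)) *
    SS (QP (t / (1 + t)) (1 / (1 + t)) n) (n + 1) (t * a - b)

lemma HH_deriv (t : ℝ) (n : ℕ) (a b : ℝ) : HasDerivAt (fun b => HH t n a b) (-FF t n a b) b := by
  unfold HH FF
  have h1 : HasDerivAt (fun b => t * a - b) (-1) b := by
    simpa using (hasDerivAt_id b).const_sub (t * a)
  have h2 := (SS_deriv (QP (t / (1 + t)) (1 / (1 + t)) n) n (t * a - b)).comp b h1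
  have h3 : HasDerivAt (fun b => -a - b) (-1) b := by
    simpa using (hasDerivAt_id b).const_sub (-a)
  have h4 := h3.exp.sub (h2.const_mul (Real.exp (-((1 + t) * a))))
  refine h4.congr_deriv ?_
  have : (fun N => QP (t / (1 + t)) (1 / (1 + t)) n (N + 1)) = QQ (t / (1 + t)) (1 / (1 + t)) n := rfl
  rw [this]; ring

lemma HH_end (t : ℝ) (n : ℕ) (a : ℝ) : HH t n a (t * a) = 0 := by
  unfold HH SS
  rw [sum_range_succ']
  have : Real.exp (-a - t * a) = Real.exp (-((1 + t) * a)) := by congr 1; ring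
  simp [QP, this]

lemma FF_deriv (t : ℝ) (ht : 0 < t) (n : ℕ) (a b : ℝ) :
    HasDerivAt (fun a => FF t (n + 1) a b) (-HH t n a b) a := by
  unfold HH FF
  have h1 : HasDerivAt (fun a => t * a - b) t a := by
    simpa using ((hasDerivAt_id a).const_mul t).sub_const b
  have h2 := (SS_deriv (QQ (t / (1 + t)) (1 / (1 + t)) (n + 1)) n (t * a - b)).comp a h1
  have h3 : HasDerivAt (fun a => -a - b) (-1) a := by
    simpa using (hasDerivAt_id a).neg.sub_const b
  have h5 : HasDerivAt (fun a => -((1 + t) * a)) (-(1 + t)) a := by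
    simpa using ((hasDerivAt_id a).const_mul (1 + t)).fun_neg
  have h4 := h3.exp.sub (h5.exp.mul h2)
  refine h4.congr_deriv ?_
  set p := t / (1 + t) with hp
  set q := 1 / (1 + t) with hq
  have e1 : SS (fun N => QQ p q (n + 1) (N + 1)) n (t * a - b) =
      SS (fun N => QQ p q (n + 1) (N + 1)) (n + 1) (t * a - b) := by
    unfold SS
    rw [sum_range_succ]
    simp only [QQ_self p q (n + 1) (n + 1) le_rfl]; ring
  have e2 : (1 + t) * SS (QQ p q (n + 1)) (n + 1) (t * a - b) =
     t * SS (fun N => QQ p q (n + 1) (N + 1)) (n + 1) (t * a - b) +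
     SS (QP p q n) (n + 1) (t * a - b) := by
    unfold SS
    rw [mul_sum, mul_sum, ← sum_add_distrib]
    apply sum_congr rfl
    intro N _
    have h1t : (1 + t) ≠ 0 := by positivity
    have : (1 + t) * QQ p q (n + 1) N = t * QQ p q (n + 1) (N + 1) + QP p q n N := by
      cases N with
      | zero => rw [QQ_rec_zero, hp, hq]; simp only [QP]; field_simp
      | succ N => rw [QQ_rec]; simp only [QP]; generalize QQ p q n N = x
                  generalize QQ p q (n + 1) _ = y
                  rw [hp, hq]; field_simp
    linear_combination ((t * a - b) ^ N / N.factorial) * this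
  simp only [Function.comp]
  rw [e1]
  linear_combination (Real.exp (-((1 + t) * a))) * e2

lemma FF_tendsto (t : ℝ) (ht : 0 < t) (n : ℕ) (b : ℝ) :
    Filter.Tendsto (fun a => FF t n a b) Filter.atTop (nhds 0) := by
  have e : (fun a => FF t n a b) = fun a => Real.exp (-a) * (Real.exp (-b) - Real.exp (-b) *
    ∑ N ∈ range n, QQ (t / (1 + t)) (1 / (1 + t)) n N / N.factorial *
      ((t * a - b) ^ N * Real.exp (-(t * a - b)))) := by
    funext a
    unfold FF SS
    rw [mul_sum, mul_sub, mul_sum, mul_sum, ← Real.exp_add, ← sub_eq_add_neg]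
    congr 1
    apply sum_congr rfl
    intro N _
    have : Real.exp (-((1 + t) * a)) = Real.exp (-a) * Real.exp (-b) * Real.exp (-(t * a - b)) := by
      rw [← Real.exp_add, ← Real.exp_add]; congr 1; ring
    rw [this]; ring
  rw [e]
  have hs : Filter.Tendsto (fun a => t * a - b) Filter.atTop Filter.atTop :=
    Filter.tendsto_atTop_add_const_right _ (-b) (Filter.Tendsto.const_mul_atTop ht Filter.tendsto_id)
  have hsum : Filter.Tendsto (fun a => ∑ N ∈ range n, QQ (t / (1 + t)) (1 / (1 + t)) n N / N.factorial *
      ((t * a - b) ^ N * Real.exp (-(t * a - b)))) Filter.atTop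
      (nhds (∑ N ∈ range n, QQ (t / (1 + t)) (1 / (1 + t)) n N / N.factorial * 0)) := by
    apply tendsto_finsetSum
    intro N _
    exact ((Real.tendsto_pow_mul_exp_neg_atTop_nhds_zero N).comp hs).const_mul _
  have := Real.tendsto_exp_neg_atTop_nhds_zero.mul ((hsum.const_mul (Real.exp (-b))).const_sub (Real.exp (-b)))
  simpa using this

lemma FF_cont (t : ℝ) (n : ℕ) (a : ℝ) : Continuous (fun b => FF t n a b) := by
  unfold FF SS; fun_prop

lemma inner_int (t : ℝ) (n : ℕ) (x b : ℝ) (hb : b ≤ t * x)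
    (hF : ∀ y, y ≤ t * x → 0 ≤ FF t n x y) :
    0 ≤ HH t n x b ∧
    ∫⁻ y in Set.Ioo b (t * x), ENNReal.ofReal (FF t n x y) = ENNReal.ofReal (HH t n x b) := by
  have h1 : ∫ y in b..(t * x), FF t n x y = HH t n x b := by
    have := intervalIntegral.integral_eq_sub_of_hasDerivAt (a := b) (b := t * x)
      (f := fun y => -HH t n x y) (f' := fun y => FF t n x y)
      (fun y _ => by simpa using (HH_deriv t n x y).fun_neg)
      ((FF_cont t n x).intervalIntegrable _ _)
    rw [this, HH_end]; ring
  constructor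
  · rw [← h1]
    exact intervalIntegral.integral_nonneg hb (fun y hy => hF y hy.2)
  · rw [← h1, intervalIntegral.integral_of_le hb, integral_Ioc_eq_integral_Ioo,
      ofReal_integral_eq_lintegral_ofReal]
    · exact ((FF_cont t n x).integrableOn_Icc).mono_set Set.Ioo_subset_Icc_self
    · exact (ae_restrict_mem measurableSet_Ioo).mono (fun y hy => hF y hy.2.le)

lemma outer_int (t : ℝ) (ht : 0 < t) (n : ℕ) (a b : ℝ) (hb : b ≤ t * a)
    (hF : ∀ x y, y ≤ t * x → 0 ≤ FF t n x y) :
    0 ≤ FF t (n + 1) a b ∧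
    ∫⁻ x in Set.Ioi a, ENNReal.ofReal (HH t n x b) = ENNReal.ofReal (FF t (n + 1) a b) := by
  have hH : ∀ x ∈ Set.Ioi a, 0 ≤ HH t n x b := fun x hx => by
    have : t * a ≤ t * x := mul_le_mul_of_nonneg_left (le_of_lt hx) ht.le
    exact (inner_int t n x b (by linarith) (hF x)).1
  have hd : ∀ x ∈ Set.Ici a, HasDerivAt (fun x => -FF t (n + 1) x b) (HH t n x b) x := fun x _ => by
    simpa using (FF_deriv t ht n x b).fun_neg
  have ht0 : Filter.Tendsto (fun x => -FF t (n + 1) x b) Filter.atTop (nhds 0) := by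
    simpa using (FF_tendsto t ht (n + 1) b).neg
  have h1 := integral_Ioi_of_hasDerivAt_of_nonneg' hd hH ht0
  have h2 := integrableOn_Ioi_deriv_of_nonneg' hd hH ht0
  have h3 : FF t (n + 1) a b = ∫ x in Set.Ioi a, HH t n x b := by rw [h1]; ring
  constructor
  · rw [h3]; exact setIntegral_nonneg measurableSet_Ioi hH
  · rw [h3, ofReal_integral_eq_lintegral_ofReal h2]
    exact (ae_restrict_mem measurableSet_Ioi).mono hH

lemma FF_nonneg (t : ℝ) (ht : 0 < t) (n : ℕ) : ∀ a b, b ≤ t * a → 0 ≤ FF t n a b := by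
  induction n with
  | zero => intro a b _; simp [FF, SS]; positivity
  | succ n ih => intro a b hb; exact (outer_int t ht n a b hb ih).1

lemma FF_double (t : ℝ) (ht : 0 < t) (n : ℕ) (a b : ℝ) (hb : b ≤ t * a) :
    ∫⁻ x in Set.Ioi a, ∫⁻ y in Set.Ioo b (t * x), ENNReal.ofReal (FF t n x y) =
      ENNReal.ofReal (FF t (n + 1) a b) := by
  rw [← (outer_int t ht n a b hb (FF_nonneg t ht n)).2]
  apply setLIntegral_congr_fun measurableSet_Ioi
  intro x hx
  have : t * a ≤ t * x := mul_le_mul_of_nonneg_left (le_of_lt hx) ht.le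
  exact (inner_int t n x b (by linarith) (FF_nonneg t ht n x)).2

open scoped ENNReal

noncomputable def k1 (c x : ℝ) : ℝ≥0∞ :=
  if 0 < x ∧ c < x⁻¹ then ENNReal.ofReal ((x ^ 2)⁻¹) else 0

noncomputable def k2 (t u v : ℝ) : ℝ≥0∞ := if v < t * u then 1 else 0

lemma k1_meas : Measurable (fun p : ℝ × ℝ => k1 p.1 p.2) := by
  unfold k1
  refine Measurable.ite ?_ (by fun_prop) measurable_const
  exact (measurableSet_lt measurable_const measurable_snd).inter
    (measurableSet_lt measurable_fst measurable_snd.inv)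

lemma k2_meas (t : ℝ) : Measurable (fun p : ℝ × ℝ => k2 t p.1 p.2) := by
  unfold k2
  refine Measurable.ite ?_ measurable_const measurable_const
  exact measurableSet_lt measurable_snd (measurable_fst.const_mul t)

lemma k1_cov (c : ℝ) (hc : 0 ≤ c) (g : ℝ → ℝ≥0∞) :
    ∫⁻ x, k1 c x * g x⁻¹ = ∫⁻ u in Set.Ioi c, g u := by
  have hs : MeasurableSet {x : ℝ | 0 < x ∧ c < x⁻¹} :=
    (measurableSet_lt measurable_const measurable_id).inter
    (measurableSet_lt measurable_const measurable_id.inv)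
  have him : (fun x : ℝ => x⁻¹) '' {x : ℝ | 0 < x ∧ c < x⁻¹} = Set.Ioi c := by
    ext u
    simp only [Set.mem_image, Set.mem_ofPred_eq, Set.mem_Ioi]
    constructor
    · rintro ⟨x, ⟨_, h⟩, rfl⟩; exact h
    · intro h
      exact ⟨u⁻¹, ⟨inv_pos.mpr (lt_of_le_of_lt hc h), by simpa using h⟩, inv_inv u⟩
  rw [← him, lintegral_image_eq_lintegral_abs_deriv_mul hs (f' := fun x => -(x ^ 2)⁻¹)
    (fun x hx => (hasDerivAt_inv hx.1.ne').hasDerivWithinAt) inv_injective.injOn,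
    ← lintegral_indicator hs]
  apply lintegral_congr
  intro x
  by_cases hx : 0 < x ∧ c < x⁻¹
  · rw [Set.indicator_of_mem (by exact hx)]
    simp [k1, hx]
  · rw [Set.indicator_of_notMem (by exact hx)]
    simp [k1, hx]

noncomputable def GG (t : ℝ) : (n : ℕ) → ℝ → ℝ → (Fin n → ℝ) → (Fin n → ℝ) → ℝ≥0∞
  | 0, a, b, _, _ => ENNReal.ofReal (Real.exp (-a - b))
  | n + 1, a, b, w, z => k1 a (w 0) * k1 b (z 0) * k2 t (w 0)⁻¹ (z 0)⁻¹ *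
      GG t n (w 0)⁻¹ (z 0)⁻¹ (Fin.tail w) (Fin.tail z)

lemma GG_meas (t : ℝ) (n : ℕ) :
    Measurable (fun p : (ℝ × ℝ) × ((Fin n → ℝ) × (Fin n → ℝ)) => GG t n p.1.1 p.1.2 p.2.1 p.2.2) := by
  induction n with
  | zero => simp only [GG]; fun_prop
  | succ n ih =>
    simp only [GG]
    have hw : Measurable (fun p : (ℝ × ℝ) × ((Fin (n+1) → ℝ) × (Fin (n+1) → ℝ)) => p.2.1 0) := by
      fun_prop
    have hz : Measurable (fun p : (ℝ × ℝ) × ((Fin (n+1) → ℝ) × (Fin (n+1) → ℝ)) => p.2.2 0) := by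
      fun_prop
    have htw : Measurable (fun p : (ℝ × ℝ) × ((Fin (n+1) → ℝ) × (Fin (n+1) → ℝ)) =>
        Fin.tail p.2.1) := by
      unfold Fin.tail; fun_prop
    have htz : Measurable (fun p : (ℝ × ℝ) × ((Fin (n+1) → ℝ) × (Fin (n+1) → ℝ)) =>
        Fin.tail p.2.2) := by
      unfold Fin.tail; fun_prop
    have m1 := k1_meas.comp ((measurable_fst.comp measurable_fst).prodMk hw)
    have m2 := k1_meas.comp ((measurable_snd.comp measurable_fst).prodMk hz)
    have m3 := (k2_meas t).comp (hw.inv.prodMk hz.inv)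
    have m4 := ih.comp ((hw.inv.prodMk hz.inv).prodMk (htw.prodMk htz))
    exact ((m1.mul m2).mul m3).mul m4

lemma lint_succ (n : ℕ) (f : (Fin (n + 1) → ℝ) → ℝ≥0∞) (hf : Measurable f) :
    ∫⁻ w, f w = ∫⁻ x : ℝ, ∫⁻ w : Fin n → ℝ, f (Fin.cons x w) := by
  have h := (volume_preserving_piFinSuccAbove (fun _ : Fin (n + 1) => ℝ) 0).symm
  rw [← h.lintegral_comp hf]
  rw [Measure.volume_eq_prod, lintegral_prod (fun a => f ((MeasurableEquiv.piFinSuccAbove (fun _ => ℝ) 0).symm a))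
    (hf.comp h.measurable).aemeasurable]
  apply lintegral_congr
  intro x
  apply lintegral_congr
  intro w
  congr 1
  simp [MeasurableEquiv.piFinSuccAbove, Fin.insertNthEquiv]

noncomputable def II (t : ℝ) (n : ℕ) (a b : ℝ) : ℝ≥0∞ :=
  ∫⁻ w : Fin n → ℝ, ∫⁻ z : Fin n → ℝ, GG t n a b w z

lemma II_succ (t : ℝ) (n : ℕ) (a b : ℝ) :
    II t (n + 1) a b =
      ∫⁻ x, ∫⁻ y, k1 a x * k1 b y * k2 t x⁻¹ y⁻¹ * II t n x⁻¹ y⁻¹ := by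
  unfold II
  have hG : Measurable (fun p : (Fin (n+1) → ℝ) × (Fin (n+1) → ℝ) => GG t (n+1) a b p.1 p.2) :=
    (GG_meas t (n + 1)).comp ((measurable_const (a := (a, b))).prodMk measurable_id)
  rw [lint_succ _ _ hG.lintegral_prod_right']
  apply lintegral_congr
  intro x
  have hm : ∀ x : ℝ, Measurable
      (fun p : ((Fin n → ℝ) × ℝ) × (Fin n → ℝ) => GG t n x⁻¹ p.1.2⁻¹ p.1.1 p.2) := fun x =>
    (GG_meas t n).comp ((measurable_const.prodMk (measurable_snd.comp measurable_fst).inv).prodMk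
      ((measurable_fst.comp measurable_fst).prodMk measurable_snd))
  have hk : ∀ x : ℝ, Measurable (fun y : ℝ => k1 a x * k1 b y * k2 t x⁻¹ y⁻¹) := fun x =>
    (measurable_const.mul (k1_meas.comp (measurable_const.prodMk measurable_id))).mul
      ((k2_meas t).comp (measurable_const.prodMk measurable_id.inv))
  have e1 : ∀ w : Fin n → ℝ, ∫⁻ z, GG t (n + 1) a b (Fin.cons x w) z =
      ∫⁻ y, ∫⁻ z, k1 a x * k1 b y * k2 t x⁻¹ y⁻¹ * GG t n x⁻¹ y⁻¹ w z := by
    intro w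
    rw [lint_succ _ (fun z => GG t (n + 1) a b (Fin.cons x w) z)
      (hG.comp ((measurable_const (a := (Fin.cons x w : Fin (n + 1) → ℝ))).prodMk measurable_id))]
    simp only [GG, Fin.cons_zero, Fin.tail_cons]
  simp_rw [e1]
  rw [lintegral_lintegral_swap]
  · apply lintegral_congr
    intro y
    have e2 : ∀ w : Fin n → ℝ,
       ∫⁻ z, k1 a x * k1 b y * k2 t x⁻¹ y⁻¹ * GG t n x⁻¹ y⁻¹ w z =
       k1 a x * k1 b y * k2 t x⁻¹ y⁻¹ * ∫⁻ z, GG t n x⁻¹ y⁻¹ w z := by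
      intro w
      rw [lintegral_const_mul]
      exact (hm x).comp ((measurable_const (a := (w, y))).prodMk measurable_id)
    simp_rw [e2]
    rw [lintegral_const_mul]
    exact ((hm x).lintegral_prod_right').comp (measurable_id.prodMk measurable_const)
  · apply Measurable.aemeasurable
    have := ((hk x).comp (measurable_snd.comp
      (measurable_fst (α := (Fin n → ℝ) × ℝ) (β := Fin n → ℝ)))).mul (hm x)
    exact this.lintegral_prod_right'

lemma II_eq (t : ℝ) (ht : 0 < t) (n : ℕ) : ∀ a b, 0 ≤ a → 0 ≤ b → b ≤ t * a →
    II t n a b = ENNReal.ofReal (FF t n a b) := by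
  induction n with
  | zero => intro a b _ _ _; simp [II, GG, FF, SS, volume_pi]
  | succ n ih =>
    intro a b ha hb hab
    rw [II_succ, ← FF_double t ht n a b hab, ← k1_cov a ha]
    apply lintegral_congr
    intro x
    by_cases hx : 0 < x ∧ a < x⁻¹
    swap
    · simp [k1, hx]
    have e : ∫⁻ y in Set.Ioo b (t * x⁻¹), ENNReal.ofReal (FF t n x⁻¹ y) =
        ∫⁻ y in Set.Ioi b, k2 t x⁻¹ y * ENNReal.ofReal (FF t n x⁻¹ y) := by
      rw [← lintegral_indicator measurableSet_Ioo, ← lintegral_indicator measurableSet_Ioi]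
      apply lintegral_congr
      intro y
      by_cases h1 : b < y <;> by_cases h2 : y < t * x⁻¹ <;> simp [Set.indicator, k2, h1, h2]
    rw [e, ← k1_cov b hb, ← lintegral_const_mul']
    · apply lintegral_congr
      intro y
      by_cases hy : 0 < y ∧ b < y⁻¹
      swap
      · simp [k1, hy]
      by_cases h2 : y⁻¹ < t * x⁻¹
      swap
      · simp [k2, h2]
      rw [ih _ _ (inv_pos.mpr hx.1).le (inv_pos.mpr hy.1).le h2.le]
      ring
    · unfold k1; split_ifs <;> simp

def CC (n : ℕ) (a : ℝ) (w : Fin n → ℝ) : Prop :=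
  (∀ i, 0 < w i) ∧ (∀ i, a < (w i)⁻¹) ∧ StrictAnti w

lemma CC_succ (n : ℕ) (a : ℝ) (w : Fin (n + 1) → ℝ) :
    CC (n + 1) a w ↔ (0 < w 0 ∧ a < (w 0)⁻¹) ∧ CC n (w 0)⁻¹ (Fin.tail w) := by
  unfold CC Fin.tail
  constructor
  · rintro ⟨h1, h2, h3⟩
    refine ⟨⟨h1 0, h2 0⟩, fun i => h1 _, fun i => ?_, fun i j hij => h3 (by simpa using hij)⟩
    exact (inv_lt_inv₀ (h1 _) (h1 _)).mpr (h3 (Fin.succ_pos i))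
  · rintro ⟨⟨h1, h2⟩, h3, h4, h5⟩
    refine ⟨?_, ?_, ?_⟩
    · intro i; refine Fin.cases h1 h3 i
    · intro i; refine Fin.cases h2 (fun i => h2.trans (h4 i)) i
    · intro i j
      refine Fin.cases ?_ (fun i => ?_) i <;> refine Fin.cases ?_ (fun j => ?_) j
      · simp
      · intro _; exact (inv_lt_inv₀ h1 (h3 j)).mp (h4 j)
      · simp
      · intro h; exact h5 (by simpa using h)

noncomputable def gg (n : ℕ) (a : ℝ) (w : Fin n → ℝ) : ℝ :=
  Real.exp (-((Fin.cons a⁻¹ w : Fin (n + 1) → ℝ) (Fin.last n))⁻¹) * ∏ i, (w i ^ 2)⁻¹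

lemma gg_nonneg (n : ℕ) (a : ℝ) (w : Fin n → ℝ) : 0 ≤ gg n a w := by
  unfold gg; positivity

lemma gg_succ (n : ℕ) (a : ℝ) (w : Fin (n + 1) → ℝ) :
    gg (n + 1) a w = (w 0 ^ 2)⁻¹ * gg n (w 0)⁻¹ (Fin.tail w) := by
  unfold gg
  rw [Fin.prod_univ_succ, inv_inv, Fin.cons_self_tail, ← Fin.succ_last, Fin.cons_succ]
  simp only [Fin.tail]
  ring

def DD (t : ℝ) (n : ℕ) (a b : ℝ) (w z : Fin n → ℝ) : Prop :=
  CC n a w ∧ CC n b z ∧ ∀ i, (z i)⁻¹ < t * (w i)⁻¹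

lemma DD_succ (t : ℝ) (n : ℕ) (a b : ℝ) (w z : Fin (n + 1) → ℝ) :
    DD t (n + 1) a b w z ↔ (0 < w 0 ∧ a < (w 0)⁻¹) ∧ (0 < z 0 ∧ b < (z 0)⁻¹) ∧
      (z 0)⁻¹ < t * (w 0)⁻¹ ∧ DD t n (w 0)⁻¹ (z 0)⁻¹ (Fin.tail w) (Fin.tail z) := by
  unfold DD
  rw [CC_succ, CC_succ, Fin.forall_fin_succ]
  simp only [Fin.tail]
  tauto

open Classical in
lemma GG_eq (t : ℝ) (n : ℕ) : ∀ a b (w z : Fin n → ℝ), GG t n a b w z =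
    if DD t n a b w z then
      ENNReal.ofReal (gg n a w * gg n b z) else 0 := by
  induction n with
  | zero =>
    intro a b w z
    have h : ∀ a (w : Fin 0 → ℝ), CC 0 a w := fun a w =>
      ⟨fun i => i.elim0, fun i => i.elim0, fun i => i.elim0⟩
    simp [h, DD, GG, gg, ← Real.exp_add, sub_eq_add_neg]
  | succ n ih =>
    intro a b w z
    simp only [GG, ih]
    simp only [DD_succ, gg_succ]
    by_cases h1 : 0 < w 0 ∧ a < (w 0)⁻¹
    swap
    · simp [k1, h1]
    by_cases h2 : 0 < z 0 ∧ b < (z 0)⁻¹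
    swap
    · simp [k1, h2]
    by_cases h3 : (z 0)⁻¹ < t * (w 0)⁻¹
    swap
    · simp [k2, h3]
    by_cases h4 : DD t n (w 0)⁻¹ (z 0)⁻¹ (Fin.tail w) (Fin.tail z)
    · rw [if_pos h4, if_pos ⟨h1, h2, h3, h4⟩]
      rw [k1, k1, k2, if_pos h1, if_pos h2, if_pos h3, mul_one,
        ← ENNReal.ofReal_mul (by positivity), ← ENNReal.ofReal_mul (by positivity)]
      congr 1; ring
    · rw [if_neg h4, if_neg (fun h => h4 h.2.2.2), mul_zero]

lemma sa_meas (m : ℕ) : MeasurableSet {w : Fin m → ℝ | StrictAnti w} := by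
  have : {w : Fin m → ℝ | StrictAnti w} = ⋂ i, ⋂ j, ⋂ (_ : i < j), {w | w j < w i} := by
    ext w; simp [StrictAnti]
  rw [this]
  exact MeasurableSet.iInter fun i => MeasurableSet.iInter fun j => MeasurableSet.iInter fun _ =>
    measurableSet_lt (measurable_pi_apply j) (measurable_pi_apply i)

lemma D_meas (m : ℕ) (t : ℝ) : MeasurableSet {p : (Fin m → ℝ) × (Fin m → ℝ) |
        StrictAnti p.2 ∧ (∀ i, 0 < p.2 i) ∧
        StrictAnti p.1 ∧ (∀ i, 0 < p.1 i) ∧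
        ∀ i, p.1 i < t * p.2 i} := by
  have hp : MeasurableSet {w : Fin m → ℝ | ∀ i, 0 < w i} := by
    rw [Set.ofPred_forall]
    exact MeasurableSet.iInter fun i => measurableSet_lt measurable_const (measurable_pi_apply i)
  refine (measurable_snd (sa_meas m)).inter ((measurable_snd hp).inter
    ((measurable_fst (sa_meas m)).inter ((measurable_fst hp).inter ?_)))
  have : MeasurableSet {p : (Fin m → ℝ) × (Fin m → ℝ) | ∀ i, p.1 i < t * p.2 i} := by
    rw [Set.ofPred_forall]
    exact MeasurableSet.iInter fun i => measurableSet_lt (by fun_prop) (by fun_prop)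
  exact this

/-- For `m ≥ 1` and `t > 0`, with
`g(w_1,…,w_m) = exp(-w_m⁻¹) ∏ w_i⁻²` (for `w_1 > ⋯ > w_m > 0`) and
`D(t) = {(w,z) : z_1 > ⋯ > z_m > 0, w strictly decreasing, 0 < w_m, w_i < t z_i}`,
the integral `∫_{D(t)} g(w) g(z) dw dz` equals
`(∑_{j=0}^{m-1} (-1)^j B_{m-1,j} k^{m-j-1}) / k^{2m-1}` where `k = 1 + 1/t`.
(Indices here are 0-based: `w i` is `w_{i+1}` of the informal statement.) -/
theorem stmt12 (m : ℕ) (hm : 1 ≤ m) (t : ℝ) (ht : 0 < t) :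
    ∫ p in {p : (Fin m → ℝ) × (Fin m → ℝ) |
        StrictAnti p.2 ∧ (∀ i, 0 < p.2 i) ∧
        StrictAnti p.1 ∧ (∀ i, 0 < p.1 i) ∧
        ∀ i, p.1 i < t * p.2 i},
      (Real.exp (-(p.1 ⟨m - 1, by omega⟩)⁻¹) * ∏ i, (p.1 i ^ 2)⁻¹) *
        (Real.exp (-(p.2 ⟨m - 1, by omega⟩)⁻¹) * ∏ i, (p.2 i ^ 2)⁻¹) =
      (∑ j ∈ Finset.range m, (-1 : ℝ) ^ j * borelTri (m - 1) j * (1 + 1 / t) ^ (m - j - 1)) /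
        (1 + 1 / t) ^ (2 * m - 1) := by
  rw [← bor_final m hm t ht]
  have hF : FF t m 0 0 = 1 - QQ (t / (1 + t)) (1 / (1 + t)) m 0 := by
    obtain ⟨n, rfl⟩ : ∃ n, m = n + 1 := ⟨m - 1, by omega⟩
    unfold FF SS
    rw [sum_range_succ']
    simp
  have hI := II_eq t ht m 0 0 le_rfl le_rfl (by simp)
  have hg : ∀ w : Fin m → ℝ,
      Real.exp (-(w ⟨m - 1, by omega⟩)⁻¹) * ∏ i, (w i ^ 2)⁻¹ = gg m 0 w := by
    intro w
    unfold gg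
    have : Fin.last m = (⟨m - 1, by omega⟩ : Fin m).succ := by
      ext; simp; omega
    rw [this, Fin.cons_succ]
  simp_rw [hg]
  have hgm : Measurable (gg m 0) := by
    have : gg m 0 = fun w => Real.exp (-(w ⟨m - 1, by omega⟩)⁻¹) * ∏ i, (w i ^ 2)⁻¹ := by
      funext w; exact (hg w).symm
    rw [this]; fun_prop
  have hD := D_meas m t
  rw [integral_eq_lintegral_of_nonneg_ae
    (Filter.Eventually.of_forall fun p => mul_nonneg (gg_nonneg _ _ _) (gg_nonneg _ _ _))
    ((hgm.comp measurable_fst).mul (hgm.comp measurable_snd)).aestronglyMeasurable,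
    ← lintegral_indicator hD, ← hF,
    ← ENNReal.toReal_ofReal (FF_nonneg t ht m 0 0 (by simp)), ← hI]
  congr 1
  have hG : Measurable (fun p : (Fin m → ℝ) × (Fin m → ℝ) => GG t m 0 0 p.1 p.2) :=
    (GG_meas t m).comp ((measurable_const (a := ((0 : ℝ), (0 : ℝ)))).prodMk measurable_id)
  unfold II
  rw [← lintegral_prod _ hG.aemeasurable, ← Measure.volume_eq_prod]
  apply lintegral_congr
  rintro ⟨w, z⟩
  rw [GG_eq]
  classical
  rw [Set.indicator_apply]
  refine if_congr ?_ rfl rfl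
  simp only [Set.mem_ofPred_eq, CC, DD]
  have key : ∀ i, 0 < w i → 0 < z i → ((z i)⁻¹ < t * (w i)⁻¹ ↔ w i < t * z i) := by
    intro i h1 h2
    rw [← div_eq_mul_inv, inv_lt_comm₀ h2 (by positivity), inv_div, div_lt_iff₀ ht, mul_comm]
  constructor
  · rintro ⟨h1, h2, h3, h4, h5⟩
    exact ⟨⟨h4, fun i => inv_pos.mpr (h4 i), h3⟩, ⟨h2, fun i => inv_pos.mpr (h2 i), h1⟩,
      fun i => (key i (h4 i) (h2 i)).mpr (h5 i)⟩
  · rintro ⟨⟨h4, _, h3⟩, ⟨h2, _, h1⟩, h5⟩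
    exact ⟨h1, h2, h3, h4, fun i => (key i (h4 i) (h2 i)).mp (h5 i)⟩
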